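/- Let G be a connected finite simple C_4-free graph such that: G is regular (all vertices have the same degree), no vertex of G is simplicial, and for every vertex u the open neighbourhood N_G(u) induces a complete multipartite graph. Then G is triangle-free, i.e., G contains no induced C_3. -/

import Mathlib

open SimpleGraph

/-- A proper colouring `c` of `G` is distinguishing if the identity is the only
automorphism of `G` preserving `c`. -/
def SimpleGraph.IsDistinguishingColoring {V α : Type*} (G : SimpleGraph V)
    (c : G.Coloring α) : Prop :=
  ∀ φ : G ≃g G, (∀ v, c (φ v) = c v) → ∀ v, φ v = v

/-- The distinguishing chromatic number of `G`: the least `k` such that `G` has a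
proper vertex colouring with `k` colours preserved only by the identity automorphism. -/
noncomputable def SimpleGraph.distChromNum {V : Type*} (G : SimpleGraph V) : ℕ :=
  sInf {k | ∃ c : G.Coloring (Fin k), G.IsDistinguishingColoring c}

/-- The maximum degree of `G`, stated without decidability assumptions. -/
noncomputable def SimpleGraph.maxDeg {V : Type*} [Fintype V] (G : SimpleGraph V) : ℕ := by
  classical exact G.maxDegree

/-- `G` contains no induced subgraph isomorphic to `H`. -/
def SimpleGraph.IsFreeOf {V W : Type*} (G : SimpleGraph V) (H : SimpleGraph W) : Prop :=
  ¬ Nonempty (H ↪g G)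

/-- A vertex is simplicial if its neighbourhood is a clique. -/
def SimpleGraph.IsSimplicialVertex {V : Type*} (G : SimpleGraph V) (v : V) : Prop :=
  G.IsClique (G.neighborSet v)

/-- `G` is complete multipartite: the vertex set can be partitioned into independent
sets (the classes of an equivalence relation) such that two vertices are adjacent
exactly when they lie in different parts. -/
def SimpleGraph.IsCompleteMultipartite' {V : Type*} (G : SimpleGraph V) : Prop :=
  ∃ r : V → V → Prop, Equivalence r ∧ ∀ u v, G.Adj u v ↔ ¬ r u v

/-- If all neighbours of `u` other than `a` are adjacent to `a`, then `u` and `a` are twins. -/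
theorem aux_twin {V : Type*} [Fintype V] (G : SimpleGraph V)
    (hreg : ∀ v w : V, (G.neighborSet v).ncard = (G.neighborSet w).ncard)
    {u a : V} (hua : G.Adj u a) (h : ∀ x, G.Adj u x → x ≠ a → G.Adj a x) :
    insert u (G.neighborSet u) = insert a (G.neighborSet a) := by
  apply Set.eq_of_subset_of_ncard_le
  · rintro x (rfl | hx)
    · exact Or.inr hua.symm
    · by_cases hxa : x = a
      · exact Or.inl hxa
      · exact Or.inr (h x hx hxa)
  · rw [Set.ncard_insert_of_notMem (by simp), Set.ncard_insert_of_notMem (by simp), hreg a u]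
  · exact Set.toFinite _

theorem aux_tri {V : Type*} [Fintype V] (G : SimpleGraph V)
    (hC4 : G.IsFreeOf (cycleGraph 4))
    (hreg : ∀ v w : V, (G.neighborSet v).ncard = (G.neighborSet w).ncard)
    (hnbhd : ∀ u : V, (G.induce (G.neighborSet u)).IsCompleteMultipartite')
    {u a b : V} (hua : G.Adj u a) (hub : G.Adj u b) (hab : G.Adj a b) :
    insert u (G.neighborSet u) = insert a (G.neighborSet a) ∨
    insert u (G.neighborSet u) = insert b (G.neighborSet b) := by
  by_contra hcon
  rw [not_or] at hcon
  obtain ⟨h1, h2⟩ := hcon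
  have ha : ∃ x, G.Adj u x ∧ x ≠ a ∧ ¬ G.Adj a x := by
    by_contra hx
    push Not at hx
    exact h1 (aux_twin G hreg hua hx)
  have hb : ∃ x, G.Adj u x ∧ x ≠ b ∧ ¬ G.Adj b x := by
    by_contra hx
    push Not at hx
    exact h2 (aux_twin G hreg hub hx)
  obtain ⟨c, huc, hca, hac⟩ := ha
  obtain ⟨d, hud, hdb, hbd⟩ := hb
  obtain ⟨r, hr, hadj⟩ := hnbhd u
  have key : ∀ x y z, G.Adj u x → G.Adj u y → G.Adj u z → G.Adj x y → ¬ G.Adj x z →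
      G.Adj y z := by
    intro x y z hx hy hz hxy hxz
    have e1 := hadj ⟨x, hx⟩ ⟨y, hy⟩
    have e2 := hadj ⟨x, hx⟩ ⟨z, hz⟩
    have e3 := hadj ⟨y, hy⟩ ⟨z, hz⟩
    simp only [comap_adj, Function.Embedding.subtype_apply] at e1 e2 e3
    rw [e3]
    intro hyz
    exact e1.1 hxy (hr.trans (not_not.1 (fun q => hxz (e2.2 q))) (hr.symm hyz))
  have hbc := key a b c hua hub huc hab hac
  have had := key b a d hub hua hud hab.symm hbd
  have hcd := key b c d hub huc hud hbc hbd
  apply hC4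
  refine ⟨⟨⟨![a, b, c, d], ?_⟩, ?_⟩⟩
  · intro i j hij
    have := hab.ne; have := hbc.ne; have := had.ne; have := hcd.ne
    fin_cases i <;> fin_cases j <;> simp_all
  · intro i j
    have := hab.symm; have := hbc.symm; have := had.symm; have := hcd.symm
    have : ¬ G.Adj c a := fun h => hac h.symm
    have : ¬ G.Adj d b := fun h => hbd h.symm
    change G.Adj (![a, b, c, d] i) (![a, b, c, d] j) ↔ _
    rw [cycleGraph_adj]
    fin_cases i <;> fin_cases j <;> first
      | exact iff_of_true (by assumption) (by decide)
      | exact iff_of_false (by assumption) (by decide)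
      | exact iff_of_false (G.irrefl) (by decide)

theorem statement_19 {V : Type*} [Fintype V] (G : SimpleGraph V)
    (hconn : G.Connected)
    (hC4 : G.IsFreeOf (cycleGraph 4))
    (hreg : ∀ v w : V, (G.neighborSet v).ncard = (G.neighborSet w).ncard)
    (hsimp : ∀ v : V, ¬ G.IsSimplicialVertex v)
    (hnbhd : ∀ u : V, (G.induce (G.neighborSet u)).IsCompleteMultipartite') :
    G.IsFreeOf (cycleGraph 3) := by
  rintro ⟨f⟩
  have tri := @aux_tri V _ G hC4 hreg hnbhd
  have twin : ∀ u v, G.Adj u v →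
      insert u (G.neighborSet u) = insert v (G.neighborSet v) → False := by
    intro u v huv htw
    have hs := hsimp u
    simp only [IsSimplicialVertex, IsClique, Set.Pairwise] at hs
    push Not at hs
    obtain ⟨x, hx, y, hy, hxy, hn⟩ := hs
    have hxv : x ∈ insert v (G.neighborSet v) := htw ▸ Or.inr hx
    have hyv : y ∈ insert v (G.neighborSet v) := htw ▸ Or.inr hy
    have hfin : y ∉ insert x (G.neighborSet x) := by
      rintro (h | h)
      · exact hxy h.symm
      · exact hn h
    rcases hxv with rfl | hxv
    · exact hfin hyv
    · rcases tri (u := x) (a := u) (b := v) hx.symm hxv.symm huv with h | h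
      · exact hfin (h ▸ Or.inr hy)
      · exact hfin (h ▸ hyv)
  have h01 : G.Adj (f 0) (f 1) := f.map_adj_iff.2 (by simp [cycleGraph_adj])
  have h02 : G.Adj (f 0) (f 2) := f.map_adj_iff.2 (by simp [cycleGraph_adj]; decide)
  have h12 : G.Adj (f 1) (f 2) := f.map_adj_iff.2 (by simp [cycleGraph_adj])
  rcases tri h01 h02 h12 with h | h
  · exact twin _ _ h01 h
  · exact twin _ _ h02 h
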